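/- Let u ≤ w be permutations in Σ_n (Bruhat order). Then the skew Schubert polynomial satisfies S_{w/u}(x) = Σ_{v ∈ Σ_n} c^w_{u,v} · S_{w₀v}(x), where the sum is over all permutations v ∈ Σ_n. -/

import Mathlib

open MvPolynomial

noncomputable section

/-- The symmetric group `Σ_n` on `{0, …, n-1}` (0-indexed model of `{1, …, n}`). -/
abbrev Perm' (n : ℕ) := Equiv.Perm (Fin n)

/-- The length `ℓ(w)`: the number of inversions of `w`. -/
def invLength {n : ℕ} (w : Perm' n) : ℕ :=
  (Finset.univ.filter (fun p : Fin n × Fin n => p.1 < p.2 ∧ w p.2 < w p.1)).card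

/-- The longest permutation `w₀ = n … 2 1`. -/
def w0 (n : ℕ) : Perm' n := Fin.revPerm

/-- `u ⋖ w` in the Bruhat order: `w = u·(k,l)` where `k < l`, `u k < u l`, and no
position strictly between `k` and `l` has a `u`-value between `u k` and `u l`. -/
def BruhatCover {n : ℕ} (u w : Perm' n) : Prop :=
  ∃ k l : Fin n, k < l ∧ u k < u l ∧
    (∀ i : Fin n, k < i → i < l → ¬(u k < u i ∧ u i < u l)) ∧
    w = u * Equiv.swap k l

/-- The Bruhat order, generated by its covers. -/
def BruhatLE {n : ℕ} : Perm' n → Perm' n → Prop :=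
  Relation.ReflTransGen BruhatCover

/-- `u →^{(k,b)} w` is a labeled cover in the labeled Bruhat order (0-indexed):
`u ⋖ w` with `u⁻¹w = (i,j)`, `i ≤ k < j` and `b = u i`. -/
def IsLabeledCover {n : ℕ} (u w : Perm' n) (k b : ℕ) : Prop :=
  ∃ i j : Fin n, i < j ∧ u i < u j ∧
    (∀ m : Fin n, i < m → m < j → ¬(u i < u m ∧ u m < u j)) ∧
    w = u * Equiv.swap i j ∧ (i : ℕ) ≤ k ∧ k < (j : ℕ) ∧ b = (u i : ℕ)

/-- Strict lexicographic order on labels `(k,b)`. -/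
def lexLt (p q : ℕ × ℕ) : Prop := p.1 < q.1 ∨ (p.1 = q.1 ∧ p.2 < q.2)

/-- A saturated labeled chain of length `m` from `u` to `w` in the labeled Bruhat order. -/
structure LabeledChain (n m : ℕ) (u w : Perm' n) where
  c : Fin (m + 1) → Perm' n
  lab : Fin m → ℕ × ℕ
  c_zero : c 0 = u
  c_last : c (Fin.last m) = w
  step : ∀ i : Fin m, IsLabeledCover (c i.castSucc) (c i.succ) (lab i).1 (lab i).2

/-- A chain is increasing if its labels strictly increase in lexicographic order. -/
def LabeledChain.Increasing {n m : ℕ} {u w : Perm' n} (γ : LabeledChain n m u w) : Prop :=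
  ∀ i j : Fin m, i < j → lexLt (γ.lab i) (γ.lab j)

/-- The type of a chain: `α_k` counts labels with first coordinate `k`. -/
def chainType {n m : ℕ} {u w : Perm' n} (γ : LabeledChain n m u w) : Fin n → ℕ :=
  fun k => (Finset.univ.filter (fun i : Fin m => (γ.lab i).1 = (k : ℕ))).card

/-- `I_α(u,w)`: the number of increasing chains from `u` to `w` of type `α`. -/
def incChainCount (n : ℕ) (u w : Perm' n) (α : Fin n → ℕ) : ℕ :=
  Nat.card ((m : ℕ) × {γ : LabeledChain n m u w // γ.Increasing ∧ chainType γ = α})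

/-- The staircase monomial `x^δ = x₁^{n-1} x₂^{n-2} ⋯ x_{n-1}`. -/
def xDelta (n : ℕ) : MvPolynomial (Fin n) ℤ :=
  ∏ i : Fin n, X i ^ (n - 1 - (i : ℕ))

/-- `S` is the family of Schubert polynomials: `S w₀ = x^δ` and
`S w - s_i·(S w) = (x_i - x_{i+1}) · S (w s_i)` whenever `ℓ(w s_i) < ℓ(w)`. -/
def IsSchubertFamily (n : ℕ) (S : Perm' n → MvPolynomial (Fin n) ℤ) : Prop :=
  S (w0 n) = xDelta n ∧
  ∀ (w : Perm' n) (i : ℕ) (h : i + 1 < n),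
    invLength (w * Equiv.swap (⟨i, by omega⟩ : Fin n) ⟨i + 1, h⟩) < invLength w →
    S w - rename (Equiv.swap (⟨i, by omega⟩ : Fin n) ⟨i + 1, h⟩) (S w) =
      (X (⟨i, by omega⟩ : Fin n) - X ⟨i + 1, h⟩) *
        S (w * Equiv.swap (⟨i, by omega⟩ : Fin n) ⟨i + 1, h⟩)

/-- The ideal generated by the elementary symmetric polynomials `e₁, …, e_n`. -/
def symIdeal (n : ℕ) : Ideal (MvPolynomial (Fin n) ℤ) :=
  Ideal.span ((fun k => esymm (Fin n) ℤ k) '' Set.Icc 1 n)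

/-- `g` is the normal form of `f` modulo the ideal of elementary symmetric polynomials :
`f ≡ g` and every monomial of `g` divides `x^δ`.  (For the degree reverse lexicographic
term order with `x₁ < ⋯ < x_n`, the normal form is exactly the unique such `g`.) -/
def IsNormalForm (n : ℕ) (f g : MvPolynomial (Fin n) ℤ) : Prop :=
  f - g ∈ symIdeal n ∧ ∀ d ∈ g.support, ∀ i : Fin n, d i ≤ n - 1 - (i : ℕ)

def finSubEquiv {n N : ℕ} (h : n ≤ N) : Fin n ≃ {i : Fin N // (i : ℕ) < n} where
  toFun i := ⟨Fin.castLE h i, i.isLt⟩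
  invFun j := ⟨(j.1 : ℕ), j.2⟩
  left_inv i := rfl
  right_inv j := rfl

/-- The standard inclusion `Σ_n ⊂ Σ_N`, extending a permutation by fixed points. -/
def permIncl {n N : ℕ} (h : n ≤ N) (u : Perm' n) : Perm' N :=
  u.extendDomain (finSubEquiv h)

/-- `δ` as an exponent vector. -/
def deltaF (n : ℕ) : Fin n →₀ ℕ :=
  Finsupp.equivFunOnFinite.symm fun i => n - 1 - (i : ℕ)

/-- The type of a chain as an exponent vector. -/
def chainTypeF {n m : ℕ} {u w : Perm' n} (γ : LabeledChain n m u w) : Fin n →₀ ℕ :=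
  Finsupp.equivFunOnFinite.symm (chainType γ)

/-- `δ` as an integral exponent vector. -/
def deltaZ (n : ℕ) : Fin n →₀ ℤ :=
  Finsupp.equivFunOnFinite.symm fun i => ((n - 1 - (i : ℕ) : ℕ) : ℤ)

/-- The type of a chain as an integral exponent vector. -/
def chainTypeZ {n m : ℕ} {u w : Perm' n} (γ : LabeledChain n m u w) : Fin n →₀ ℤ :=
  Finsupp.equivFunOnFinite.symm fun k => ((chainType γ k : ℕ) : ℤ)

/-- The inclusion of polynomials into Laurent polynomials. -/
def toLaurent (n : ℕ) : MvPolynomial (Fin n) ℤ →+* AddMonoidAlgebra ℤ (Fin n →₀ ℤ) :=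
  AddMonoidAlgebra.mapDomainRingHom ℤ (Finsupp.mapRange.addMonoidHom (Nat.castAddMonoidHom ℤ))

/-- The complete homogeneous symmetric polynomial `h_a(x₁, …, x_k)` inside
`ℤ[x₁, …, x_n]` (variables are 0-indexed, so the first `k` variables are used). -/
def hpoly (n k a : ℕ) : MvPolynomial (Fin n) ℤ :=
  ∑ s ∈ (Finset.univ.filter (fun i : Fin n => (i : ℕ) < k)).sym a,
    ((s : Multiset (Fin n)).map X).prod

/-- `h_α = h_{α₁}(x₁) h_{α₂}(x₁,x₂) ⋯ h_{α_{n-1}}(x₁, …, x_{n-1})` (0-indexed `α`). -/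
def hAlpha (n : ℕ) (α : Fin n → ℕ) : MvPolynomial (Fin n) ℤ :=
  ∏ i : Fin n, hpoly n ((i : ℕ) + 1) (α i)

/- ## rc-graphs (0-indexed pairs: the paper's pair `(k,b)` is `(k-1, b-1)`) -/

/-- The linear order on rc-graph positions: `(k,b) ≤ (j,a)  ⇔  k < j, or k = j and b ≥ a`. -/
def rcLE (p q : ℕ × ℕ) : Prop := p.1 < q.1 ∨ (p.1 = q.1 ∧ q.2 ≤ p.2)

instance : DecidableRel rcLE := fun p q => by unfold rcLE; exact inferInstance
instance : IsTrans (ℕ × ℕ) rcLE :=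
  ⟨fun a b c h1 h2 => by unfold rcLE at h1 h2 ⊢; omega⟩
instance : IsAntisymm (ℕ × ℕ) rcLE :=
  ⟨fun a b h1 h2 => by unfold rcLE at h1 h2; rw [Prod.ext_iff]; omega⟩
instance : IsTotal (ℕ × ℕ) rcLE := ⟨fun a b => by unfold rcLE; omega⟩

/-- The adjacent transposition `s_{i+1} = (i, i+1)` (0-indexed positions). -/
def adjT (n : ℕ) (i : ℕ) : Perm' n :=
  if h : i + 1 < n then Equiv.swap ⟨i, by omega⟩ ⟨i + 1, h⟩ else 1

/-- The word `d(R)` of a set of positions: list its elements in the order `rcLE` and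
record `k + b` for each pair (0-indexed version of `k + b - 1`). -/
def rcWord (R : Finset (ℕ × ℕ)) : List ℕ :=
  (R.sort rcLE).map (fun p => p.1 + p.2)

/-- The permutation given by a word in the adjacent transpositions. -/
def wordPerm (n : ℕ) (l : List ℕ) : Perm' n :=
  (l.map (adjT n)).prod

/-- The permutation of a set of rc-positions. -/
def rcPerm (n : ℕ) (R : Finset (ℕ × ℕ)) : Perm' n := wordPerm n (rcWord R)

/-- `R` consists of valid rc-positions: (0-indexed) `k + b + 2 ≤ n`. -/
def IsRC (n : ℕ) (R : Finset (ℕ × ℕ)) : Prop := ∀ p ∈ R, p.1 + p.2 + 2 ≤ n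

/-- `R ∈ 𝓡(w)`: `R` is an rc-graph associated to `w`, i.e. `d(R)` is a reduced word for `w`. -/
def AssocRC (n : ℕ) (R : Finset (ℕ × ℕ)) (w : Perm' n) : Prop :=
  IsRC n R ∧ rcPerm n R = w ∧ R.card = invLength w

/-- All valid rc-positions for `Σ_n`. -/
def fullRC (n : ℕ) : Finset (ℕ × ℕ) :=
  (Finset.range n ×ˢ Finset.range n).filter (fun p => p.1 + p.2 + 2 ≤ n)

/-- One greedy step: adjoin the lexicographically smallest valid pair not in `R`. -/
def GreedyStep (n : ℕ) (R R' : Finset (ℕ × ℕ)) : Prop :=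
  ∃ p : ℕ × ℕ, p ∉ R ∧ p.1 + p.2 + 2 ≤ n ∧
    (∀ q : ℕ × ℕ, q.1 + q.2 + 2 ≤ n → q ∉ R → (p.1 < q.1 ∨ (p.1 = q.1 ∧ p.2 ≤ q.2))) ∧
    R' = insert p R

/-- The exponent of `x_i` in `x^R`. -/
def rcType (n : ℕ) (R : Finset (ℕ × ℕ)) : Fin n → ℕ :=
  fun i => (R.filter (fun p => p.1 = (i : ℕ))).card

/-- `γ = γ(R)`: the chain `γ` is produced from `R` by the greedy sequence. -/
def GreedyRel (n : ℕ) {m : ℕ} (w : Perm' n) (R : Finset (ℕ × ℕ))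
    (γ : LabeledChain n m w (w0 n)) : Prop :=
  ∃ Rs : ℕ → Finset (ℕ × ℕ), Rs 0 = R ∧
    (∀ i < m, GreedyStep n (Rs i) (Rs (i + 1))) ∧
    (∀ i : Fin m, γ.lab i ∉ Rs (i : ℕ) ∧ Rs ((i : ℕ) + 1) = insert (γ.lab i) (Rs (i : ℕ))) ∧
    (∀ i : Fin (m + 1), rcPerm n (Rs (i : ℕ)) = γ.c i)

section DividedDifference

lemma X_sub_X_ne_zero {σ : Type*} {a b : σ} (hab : a ≠ b) : (X a - X b : MvPolynomial σ ℤ) ≠ 0 :=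
  sub_ne_zero.2 fun h => hab (X_injective h)

variable {σ : Type*} [DecidableEq σ]

/-- `f'` is the divided difference of `f` in the variables `x_a`, `x_b`. -/
def IsDividedDifference (a b : σ) (f f' : MvPolynomial σ ℤ) : Prop :=
  f - rename (Equiv.swap a b) f = (X a - X b) * f'

lemma rename_swap_rename_swap (a b : σ) (f : MvPolynomial σ ℤ) :
    rename (Equiv.swap a b) (rename (Equiv.swap a b) f) = f := by
  rw [rename_rename]
  convert rename_id_apply f
  ext x
  simp

lemma rename_swap_X_sub_X (a b : σ) :
    rename (Equiv.swap a b) (X a - X b : MvPolynomial σ ℤ) = -(X a - X b) := by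
  simp

namespace IsDividedDifference

variable {a b : σ} {f f' g g' : MvPolynomial σ ℤ}

lemma unique (hab : a ≠ b) (h : IsDividedDifference a b f f') (h' : IsDividedDifference a b f g') :
    f' = g' :=
  mul_left_cancel₀ (X_sub_X_ne_zero hab) (h.symm.trans h')

lemma symmetric (hab : a ≠ b) (h : IsDividedDifference a b f f') :
    rename (Equiv.swap a b) f' = f' := by
  apply mul_left_cancel₀ (X_sub_X_ne_zero hab)
  have h2 := congrArg (rename (Equiv.swap a b)) h
  rw [map_sub, map_mul, rename_swap_rename_swap, rename_swap_X_sub_X] at h2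
  rw [IsDividedDifference] at h
  linear_combination h2 + h

lemma symmetric_mul (h : IsDividedDifference a b f f') (hg : rename (Equiv.swap a b) g = g) :
    IsDividedDifference a b (g * f) (g * f') := by
  rw [IsDividedDifference] at h ⊢
  rw [map_mul, hg]
  linear_combination g * h

lemma of_symmetric (hf : rename (Equiv.swap a b) f = f) : IsDividedDifference a b f 0 := by
  rw [IsDividedDifference, hf]; ring

/-- The antisymmetrised Leibniz rule: `f' g - f g'` is invariant under the swap. -/
lemma symmetric_wronskian (hab : a ≠ b) (hf : IsDividedDifference a b f f')
    (hg : IsDividedDifference a b g g') :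
    rename (Equiv.swap a b) (f' * g - f * g') = f' * g - f * g' := by
  have hf' := hf.symmetric hab
  have hg' := hg.symmetric hab
  rw [IsDividedDifference] at hf hg
  rw [map_sub, map_mul, map_mul, hf', hg']
  linear_combination g' * hf - f' * hg

end IsDividedDifference

lemma exists_isDividedDifference (a b : σ) (f : MvPolynomial σ ℤ) :
    ∃ f', IsDividedDifference a b f f' := by
  induction f using MvPolynomial.induction_on with
  | C r => exact ⟨0, .of_symmetric (by simp)⟩
  | add p q hp hq =>
    obtain ⟨p', hp⟩ := hp
    obtain ⟨q', hq⟩ := hq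
    refine ⟨p' + q', ?_⟩
    rw [IsDividedDifference] at hp hq ⊢
    rw [map_add]
    linear_combination hp + hq
  | mul_X p k hp =>
    obtain ⟨p', hp⟩ := hp
    have hk : ∃ r, IsDividedDifference a b (X k : MvPolynomial σ ℤ) r := by
      by_cases ha : k = a
      · subst ha; exact ⟨1, by simp [IsDividedDifference]⟩
      by_cases hb : k = b
      · subst hb; exact ⟨-1, by simp [IsDividedDifference]⟩
      · exact ⟨0, .of_symmetric (by simp [Equiv.swap_apply_of_ne_of_ne ha hb])⟩
    obtain ⟨r, hr⟩ := hk
    refine ⟨p' * X k + rename (Equiv.swap a b) p * r, ?_⟩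
    rw [IsDividedDifference] at hp hr ⊢
    rw [map_mul]
    linear_combination X k * hp + rename (Equiv.swap a b) p * hr

lemma isHomogeneous_of_X_sub_X_mul {a b : σ} (hab : a ≠ b) {q : MvPolynomial σ ℤ} {k : ℕ}
    (h : ((X a - X b) * q).IsHomogeneous (k + 1)) : q.IsHomogeneous k := by
  have hlin : (X a - X b : MvPolynomial σ ℤ).IsHomogeneous 1 :=
    (isHomogeneous_X ℤ a).sub (isHomogeneous_X ℤ b)
  have key (j : ℕ) : homogeneousComponent (j + 1) ((X a - X b) * q) =
      (X a - X b) * homogeneousComponent j q := by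
    conv_lhs => rw [← sum_homogeneousComponent q, Finset.mul_sum, map_sum]
    have hterm (i : ℕ) : homogeneousComponent (j + 1) ((X a - X b) * homogeneousComponent i q) =
        if i = j then (X a - X b) * homogeneousComponent i q else 0 := by
      rw [homogeneousComponent_of_mem (n := 1 + i)
        (hlin.mul (homogeneousComponent_isHomogeneous i q))]
      split_ifs <;> first | rfl | omega
    simp only [hterm, Finset.sum_ite_eq', Finset.mem_range]
    split_ifs with hj
    · rfl
    · rw [homogeneousComponent_eq_zero _ _ (by omega), mul_zero]
  intro d hd
  by_contra hne
  have hz : homogeneousComponent d.degree q = 0 := by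
    apply mul_left_cancel₀ (X_sub_X_ne_zero hab)
    rw [← key, homogeneousComponent_of_mem h, mul_zero, if_neg]
    intro hk
    apply hne
    rw [show (1 : σ → ℕ) = fun _ => 1 from rfl, ← Finsupp.degree_eq_weight_one]
    simpa using (show d.degree = k by omega)
  have := congrArg (coeff d) hz
  rw [coeff_homogeneousComponent, if_pos rfl] at this
  exact hd (by simpa using this)

lemma degreeOf_add_le_of_X_sub_X_mul {a b : σ} (hab : a ≠ b) {q : MvPolynomial σ ℤ} (hq : q ≠ 0)
    (i : σ) :
    degreeOf i q + (if i = a ∨ i = b then 1 else 0) ≤ degreeOf i ((X a - X b) * q) := by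
  rw [degreeOf_mul_eq (X_sub_X_ne_zero hab) hq, add_comm]
  gcongr
  split_ifs with hi
  · have hc : (Finsupp.single i 1 : σ →₀ ℕ) ∈ (X a - X b : MvPolynomial σ ℤ).support := by
      rw [mem_support_iff, coeff_sub, coeff_X, coeff_X]
      obtain rfl | rfl := hi <;> simp [Finsupp.single_left_inj, hab, hab.symm]
    simpa using degreeOf_le_iff.1 (le_refl (degreeOf i _)) _ hc
  · exact Nat.zero_le _

end DividedDifference

section Permutations

variable {n : ℕ}

lemma mul_swap_invLength (w : Perm' n) (i : ℕ) (h : i + 1 < n)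
    (hw : w ⟨i + 1, h⟩ < w ⟨i, by omega⟩) :
    invLength w = invLength (w * Equiv.swap (⟨i, by omega⟩ : Fin n) ⟨i + 1, h⟩) + 1 := by
  set a : Fin n := ⟨i, by omega⟩
  set b : Fin n := ⟨i + 1, h⟩
  have hmem : (a, b) ∈ Finset.univ.filter
      (fun p : Fin n × Fin n => p.1 < p.2 ∧ w p.2 < w p.1) := by
    simp [a, b, hw]
  have hlt (p q : Fin n) (hpq : p < q) (hne : ¬(p = a ∧ q = b)) :
      Equiv.swap a b p < Equiv.swap a b q := by
    simp only [Equiv.swap_apply_def]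
    simp only [a, b, Fin.lt_def, Fin.ext_iff] at hpq hne ⊢
    split_ifs <;> (try simp only) <;> omega
  rw [invLength, invLength, ← Finset.card_erase_add_one hmem]
  congr 1
  refine Finset.card_bij' (fun p _ => (Equiv.swap a b p.1, Equiv.swap a b p.2))
    (fun p _ => (Equiv.swap a b p.1, Equiv.swap a b p.2)) ?_ ?_ ?_ ?_
  · rintro ⟨p, q⟩ hp
    rw [Finset.mem_erase, Finset.mem_filter] at hp
    rw [Finset.mem_filter]
    refine ⟨Finset.mem_univ _, hlt p q hp.2.2.1 fun h => hp.1 (by rw [h.1, h.2]), ?_⟩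
    simpa using hp.2.2.2
  · rintro ⟨p, q⟩ hp
    rw [Finset.mem_filter] at hp
    rw [Finset.mem_erase, Finset.mem_filter]
    have hne : ¬(p = a ∧ q = b) := by
      rintro ⟨rfl, rfl⟩
      exact absurd hp.2.2 (by simpa using hw.le)
    refine ⟨fun h => ?_, Finset.mem_univ _, hlt p q hp.2.1 hne, by simpa using hp.2.2⟩
    rw [Prod.mk.injEq, Equiv.swap_apply_eq_iff, Equiv.swap_apply_eq_iff] at h
    have hlt := hp.2.1
    rw [h.1, h.2, Equiv.swap_apply_left, Equiv.swap_apply_right] at hlt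
    exact absurd hlt (by simp [a, b])
  · simp
  · simp

/-- Every permutation is reached from the identity by ascents. -/
lemma perm_induction_ascent {P : Perm' n → Prop} (one : P 1)
    (step : ∀ (w : Perm' n) (i : ℕ) (h : i + 1 < n), w ⟨i, by omega⟩ < w ⟨i + 1, h⟩ → P w →
      P (w * Equiv.swap (⟨i, by omega⟩ : Fin n) ⟨i + 1, h⟩)) (w : Perm' n) : P w := by
  induction hl : invLength w using Nat.strong_induction_on generalizing w with
  | _ l ih =>
    by_cases hw : ∃ (i : ℕ) (h : i + 1 < n), w ⟨i + 1, h⟩ < w ⟨i, by omega⟩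
    · obtain ⟨i, h, hw⟩ := hw
      have hlen := mul_swap_invLength w i h hw
      have := step (w * Equiv.swap (⟨i, by omega⟩ : Fin n) ⟨i + 1, h⟩) i h (by simpa using hw)
        (ih _ (by omega) _ rfl)
      simpa [mul_assoc] using this
    · push Not at hw
      have hmono : Monotone w := by
        cases n with
        | zero => exact fun i => i.elim0
        | succ n => exact Fin.monotone_iff_le_succ.2 fun i => hw i (by omega)
      rwa [(Equiv.Perm.monotone_iff w).1 hmono]

end Permutations

section AltCoeff

variable {n : ℕ}

/-- The coefficient of `x^δ` in the antisymmetrisation of a polynomial. -/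
def altCoeff (n : ℕ) : MvPolynomial (Fin n) ℤ →ₗ[ℤ] ℤ :=
  ∑ w : Perm' n, (Equiv.Perm.sign w : ℤ) • lcoeff ℤ ((deltaF n).mapDomain w)

lemma altCoeff_apply (f : MvPolynomial (Fin n) ℤ) :
    altCoeff n f =
      ∑ w : Perm' n, (Equiv.Perm.sign w : ℤ) * coeff ((deltaF n).mapDomain w) f := by
  simp [altCoeff]

lemma altCoeff_rename_swap {a b : Fin n} (hab : a ≠ b) (f : MvPolynomial (Fin n) ℤ) :
    altCoeff n (rename (Equiv.swap a b) f) = -altCoeff n f := by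
  rw [altCoeff_apply, altCoeff_apply, ← Finset.sum_neg_distrib]
  refine Fintype.sum_equiv (Equiv.mulLeft (Equiv.swap a b)) _ _ fun w => ?_
  have hd : (deltaF n).mapDomain w =
      ((deltaF n).mapDomain (Equiv.swap a b * w)).mapDomain (Equiv.swap a b) := by
    rw [← Finsupp.mapDomain_comp]
    congr 1
    ext x
    simp
  rw [hd, coeff_rename_mapDomain _ (Equiv.injective _)]
  simp [Equiv.Perm.sign_swap hab]

lemma altCoeff_eq_zero_of_symmetric {a b : Fin n} (hab : a ≠ b) {f : MvPolynomial (Fin n) ℤ}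
    (hf : rename (Equiv.swap a b) f = f) : altCoeff n f = 0 := by
  have := altCoeff_rename_swap hab f
  rw [hf] at this
  omega

/-- Divided differences are self-adjoint for the pairing `(f, g) ↦ altCoeff n (f * g)`. -/
lemma altCoeff_mul_comm_dividedDifference {a b : Fin n} (hab : a ≠ b)
    {f f' g g' : MvPolynomial (Fin n) ℤ} (hf : IsDividedDifference a b f f')
    (hg : IsDividedDifference a b g g') : altCoeff n (f' * g) = altCoeff n (f * g') := by
  have := altCoeff_eq_zero_of_symmetric hab (hf.symmetric_wronskian hab hg)
  rw [map_sub] at this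
  omega

lemma xDelta_eq_monomial (n : ℕ) : xDelta n = monomial (deltaF n) 1 := by
  rw [xDelta, monomial_eq, Finsupp.prod_fintype _ _ (by simp)]
  simp [deltaF]

lemma eq_one_of_deltaF_le_mapDomain {w : Perm' n} (h : deltaF n ≤ (deltaF n).mapDomain w) :
    w = 1 := by
  have hle (i : Fin n) : deltaF n (w i) ≤ deltaF n i := by
    simpa [Finsupp.mapDomain_apply w.injective] using h (w i)
  have heq (i : Fin n) : deltaF n (w i) = deltaF n i :=
    (Finset.sum_eq_sum_iff_of_le fun i _ => hle i).1 (Equiv.sum_comp w (deltaF n)) i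
      (Finset.mem_univ i)
  ext i
  have := heq i
  simp only [deltaF, Finsupp.equivFunOnFinite_symm_apply_apply] at this
  have := (w i).isLt
  rw [Equiv.Perm.one_apply]
  omega

lemma altCoeff_mul_xDelta (f : MvPolynomial (Fin n) ℤ) :
    altCoeff n (f * xDelta n) = constantCoeff f := by
  rw [altCoeff_apply, Fintype.sum_eq_single 1]
  · rw [xDelta_eq_monomial, coeff_mul_monomial']
    simp [constantCoeff_eq]
  · intro w hw
    rw [xDelta_eq_monomial, coeff_mul_monomial', if_neg, mul_zero]
    exact fun h => hw (eq_one_of_deltaF_le_mapDomain h)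

end AltCoeff

section Staircase

variable {n : ℕ}

/-- The exponents of the monomials dividing `x^δ`. -/
def staircase (n : ℕ) : Set (Fin n →₀ ℕ) := {d | ∀ i : Fin n, d i ≤ n - 1 - (i : ℕ)}

/-- A staircase exponent is a choice of `d i < n - i` for every `i`. -/
def staircaseEquiv (n : ℕ) : staircase n ≃ ∀ i : Fin n, Fin (n - i) where
  toFun d i := ⟨d.1 i, by have := d.2 i; omega⟩
  invFun e := ⟨Finsupp.equivFunOnFinite.symm fun i => e i, fun i => by
    have := (e i).isLt
    simp only [Finsupp.equivFunOnFinite_symm_apply_apply]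
    omega⟩
  left_inv d := by ext i; simp
  right_inv e := by ext i; simp

lemma nonempty_staircase_equiv_perm (n : ℕ) : Nonempty (staircase n ≃ Perm' n) := by
  have : Finite (staircase n) := .of_equiv _ (staircaseEquiv n).symm
  rw [← Finite.card_eq, Nat.card_congr (staircaseEquiv n), Nat.card_perm, Nat.card_fin,
    Nat.card_pi]
  simp only [Nat.card_fin]
  rw [Fin.prod_univ_eq_prod_range (fun i => n - i) n, ← Nat.descFactorial_eq_prod_range,
    Nat.descFactorial_self]

/-- A linear functional-valued map out of the staircase module with a family of
preimages of the standard basis is injective. -/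
lemma staircase_injective (E : MvPolynomial (Fin n) ℤ →ₗ[ℤ] (Perm' n → ℤ))
    (T : Perm' n → MvPolynomial (Fin n) ℤ) (hT : ∀ v, T v ∈ restrictSupport ℤ (staircase n))
    (hET : ∀ v, E (T v) = Pi.single v 1) {f : MvPolynomial (Fin n) ℤ}
    (hf : f ∈ restrictSupport ℤ (staircase n)) (hEf : E f = 0) : f = 0 := by
  obtain ⟨σ⟩ := nonempty_staircase_equiv_perm n
  let e : restrictSupport ℤ (staircase n) ≃ₗ[ℤ] (Perm' n → ℤ) :=
    ((basisRestrictSupport ℤ (staircase n)).reindex σ).equivFun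
  let E' := E ∘ₗ (restrictSupport ℤ (staircase n)).subtype
  have hsurj : Function.Surjective E' := fun c => by
    refine ⟨∑ v, c v • ⟨T v, hT v⟩, ?_⟩
    rw [map_sum]
    simp only [map_smul, E', LinearMap.comp_apply, Submodule.subtype_apply, hET]
    exact (pi_eq_sum_univ' c).symm
  have hinj : Function.Injective E' :=
    OrzechProperty.injective_of_surjective_of_injective e.toLinearMap E' e.injective hsurj
  have := @hinj ⟨f, hf⟩ 0 (by rw [map_zero]; exact hEf)
  exact congrArg Subtype.val this

end Staircase

namespace IsSchubertFamily

variable {n : ℕ} {S : Perm' n → MvPolynomial (Fin n) ℤ}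

lemma isDividedDifference (hS : IsSchubertFamily n S) (w : Perm' n) (i : ℕ) (h : i + 1 < n)
    (hw : w ⟨i + 1, h⟩ < w ⟨i, by omega⟩) :
    IsDividedDifference (⟨i, by omega⟩ : Fin n) ⟨i + 1, h⟩ (S w)
      (S (w * Equiv.swap ⟨i, by omega⟩ ⟨i + 1, h⟩)) :=
  hS.2 w i h (by rw [mul_swap_invLength w i h hw]; exact Nat.lt_succ_self _)

lemma isDividedDifference_w0_mul (hS : IsSchubertFamily n S) (w : Perm' n) (i : ℕ)
    (h : i + 1 < n) (hw : w ⟨i, by omega⟩ < w ⟨i + 1, h⟩) :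
    IsDividedDifference (⟨i, by omega⟩ : Fin n) ⟨i + 1, h⟩ (S (w0 n * w))
      (S (w0 n * (w * Equiv.swap ⟨i, by omega⟩ ⟨i + 1, h⟩))) := by
  rw [← mul_assoc]
  exact hS.isDividedDifference (w0 n * w) i h (by simpa [w0] using hw)

/-- If `w s_i > w`, then the divided difference of `S_w` vanishes. -/
lemma isDividedDifference_zero (hS : IsSchubertFamily n S) (w : Perm' n) (i : ℕ)
    (h : i + 1 < n) (hw : w ⟨i, by omega⟩ < w ⟨i + 1, h⟩) :
    IsDividedDifference (⟨i, by omega⟩ : Fin n) ⟨i + 1, h⟩ (S w) 0 := by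
  have hi : i < n := by omega
  have := hS.isDividedDifference (w * Equiv.swap ⟨i, hi⟩ ⟨i + 1, h⟩) i h (by simpa using hw)
  rw [mul_assoc, Equiv.swap_mul_self, mul_one] at this
  exact .of_symmetric (this.symmetric (by simp))

lemma mem_staircase (hS : IsSchubertFamily n S) (w : Perm' n) :
    S w ∈ restrictSupport ℤ (staircase n) := by
  suffices ∀ w i, degreeOf i (S (w0 n * w)) ≤ n - 1 - (i : ℕ) by
    intro d hd i
    have := this (w0 n * w) i
    rw [← mul_assoc, show w0 n * w0 n = 1 by ext; simp [w0], one_mul] at this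
    exact degreeOf_le_iff.1 this d hd
  intro w
  induction w using perm_induction_ascent with
  | one =>
    intro i
    rw [mul_one, hS.1, xDelta_eq_monomial, degreeOf_monomial_eq _ _ one_ne_zero]
    simp [deltaF]
  | step w i h hw ih =>
    have hd := hS.isDividedDifference_w0_mul w i h hw
    set q := S (w0 n * (w * Equiv.swap ⟨i, by omega⟩ ⟨i + 1, h⟩))
    set p := S (w0 n * w)
    generalize ha : (⟨i, by omega⟩ : Fin n) = a at hd
    generalize hb : (⟨i + 1, h⟩ : Fin n) = b at hd
    have ha' : (a : ℕ) = i := by rw [← ha]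
    have hb' : (b : ℕ) = i + 1 := by rw [← hb]
    have hab : a ≠ b := fun hab => by omega
    intro k
    by_cases hq : q = 0
    · simp [hq]
    have h1 := degreeOf_add_le_of_X_sub_X_mul hab hq k
    rw [← hd] at h1
    have h2 := h1.trans (degreeOf_sub_le _ _ _)
    have h3 := degreeOf_rename_of_injective (p := p) (Equiv.swap a b).injective (Equiv.swap a b k)
    rw [Equiv.swap_apply_self] at h3
    rw [h3] at h2
    have h4 := ih k
    have h5 := ih (Equiv.swap a b k)
    rcases eq_or_ne k a with rfl | hka
    · rw [Equiv.swap_apply_left] at h2 h5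
      simp only [true_or, if_true] at h2
      omega
    rcases eq_or_ne k b with rfl | hkb
    · rw [Equiv.swap_apply_right] at h2 h5
      simp only [or_true, if_true] at h2
      omega
    rw [Equiv.swap_apply_of_ne_of_ne hka hkb] at h2 h5
    simp only [hka, hkb, or_self, if_false] at h2
    omega

lemma exists_isHomogeneous (hS : IsSchubertFamily n S) (w : Perm' n) :
    ∃ k, (S w).IsHomogeneous k := by
  suffices ∀ w, ∃ k, (S (w0 n * w)).IsHomogeneous k by
    obtain ⟨k, hk⟩ := this (w0 n * w)
    rw [← mul_assoc, show w0 n * w0 n = 1 by ext; simp [w0], one_mul] at hk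
    exact ⟨k, hk⟩
  intro w
  induction w using perm_induction_ascent with
  | one => exact ⟨_, by rw [mul_one, hS.1, xDelta_eq_monomial]; exact isHomogeneous_monomial _ rfl⟩
  | step w i h hw ih =>
    obtain ⟨k, hk⟩ := ih
    have hd := hS.isDividedDifference_w0_mul w i h hw
    have hdiff := hk.sub (hk.rename_isHomogeneous
      (f := Equiv.swap (⟨i, by omega⟩ : Fin n) ⟨i + 1, h⟩))
    cases k with
    | zero =>
      refine ⟨0, ?_⟩
      have hC := hk.totalDegree_le
      rw [Nat.le_zero, totalDegree_eq_zero_iff_eq_C] at hC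
      rw [IsDividedDifference, hC, rename_C, sub_self] at hd
      rw [(mul_eq_zero.1 hd.symm).resolve_left (X_sub_X_ne_zero (by simp))]
      exact isHomogeneous_zero _ _ _
    | succ k =>
      rw [hd] at hdiff
      exact ⟨k, isHomogeneous_of_X_sub_X_mul (by simp) hdiff⟩

end IsSchubertFamily

section Dominant

variable {N : ℕ}

lemma isDividedDifference_prod_X_pow {a b : Fin N} {d d' : Fin N → ℕ}
    (ha : d a = d' a + 1) (hd : ∀ i, i ≠ a → d i = d' i) (hd' : d' a = d' b) :
    IsDividedDifference a b (∏ i, (X i : MvPolynomial (Fin N) ℤ) ^ d i)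
      (∏ i, (X i : MvPolynomial (Fin N) ℤ) ^ d' i) := by
  have hprod : (∏ i, (X i : MvPolynomial (Fin N) ℤ) ^ d i) = X a * ∏ i, X i ^ d' i := by
    rw [Fintype.prod_eq_mul_prod_compl a, Fintype.prod_eq_mul_prod_compl a (fun i => X i ^ d' i),
      ha, pow_succ', mul_assoc]
    congr 2
    refine Finset.prod_congr rfl fun i hi => ?_
    rw [hd i (by simpa using hi)]
  have hsymm : rename (Equiv.swap a b) (∏ i, (X i : MvPolynomial (Fin N) ℤ) ^ d' i) =
      ∏ i, X i ^ d' i := by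
    rw [map_prod]
    refine Fintype.prod_equiv (Equiv.swap a b) _ _ fun i => ?_
    rw [map_pow, rename_X]
    congr 1
    rw [Equiv.swap_apply_def]
    split_ifs with h1 h2 <;> simp [*]
  rw [hprod, mul_comm, mul_comm _ (X a), mul_comm (X a)]
  have := (show IsDividedDifference a b (X a : MvPolynomial (Fin N) ℤ) 1 by
    simp [IsDividedDifference]).symmetric_mul hsymm
  rwa [mul_one] at this

namespace IsSchubertFamily

variable {S : Perm' N → MvPolynomial (Fin N) ℤ}

/-- The Schubert polynomial of a permutation reversing `0, …, m - 1` and fixing the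
remaining points is a staircase monomial. -/
lemma eq_prod_X_pow_of_reverse (hS : IsSchubertFamily N S) {m : ℕ} (hm : m ≤ N) (w : Perm' N)
    (hw : ∀ i, (w i : ℕ) = if (i : ℕ) < m then m - 1 - (i : ℕ) else i) :
    S w = ∏ i : Fin N, X i ^ (m - 1 - (i : ℕ)) := by
  induction hm using Nat.decreasingInduction generalizing w with
  | self =>
    have : w = w0 N := by
      ext i
      rw [hw, if_pos i.isLt, w0, Fin.revPerm_apply, Fin.val_rev]
      omega
    rw [this, hS.1, xDelta]
  | of_succ m hm ih =>
    have aux (k : ℕ) (hk : k ≤ m) (w : Perm' N) (hw : ∀ i, (w i : ℕ) =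
        if (i : ℕ) < k then m - 1 - (i : ℕ) else if (i : ℕ) = k then m else
          if (i : ℕ) ≤ m then m - i else i) :
        S w = ∏ i : Fin N, X i ^ (if (i : ℕ) < k then m - 1 - (i : ℕ) else m - i) := by
      induction k generalizing w with
      | zero =>
        rw [ih w fun i => by rw [hw]; split_ifs <;> omega]
        simp
      | succ k ihk =>
        have hk' : k + 1 < N := by omega
        set a : Fin N := ⟨k, by omega⟩ with ha
        set b : Fin N := ⟨k + 1, hk'⟩ with hb
        have hab : a ≠ b := by simp [a, b]
        have hS' := ihk (by omega) (w * Equiv.swap a b) fun i => by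
          rw [Equiv.Perm.mul_apply, hw]
          rcases eq_or_ne i a with rfl | hia
          · rw [Equiv.swap_apply_left]
            simp [hb, ha]
          rcases eq_or_ne i b with rfl | hib
          · rw [Equiv.swap_apply_right]
            simp only [ha, hb]
            split_ifs <;> omega
          rw [Equiv.swap_apply_of_ne_of_ne hia hib]
          rw [Ne, Fin.ext_iff] at hia hib
          simp only [ha, hb] at hia hib
          split_ifs <;> omega
        have hdesc : (w * Equiv.swap a b) b < (w * Equiv.swap a b) a := by
          simp only [Equiv.Perm.mul_apply, Equiv.swap_apply_left, Equiv.swap_apply_right,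
            Fin.lt_def, hw]
          simp [a, b]
          omega
        have hdd := hS.isDividedDifference (w * Equiv.swap a b) k hk' hdesc
        rw [mul_assoc, Equiv.swap_mul_self, mul_one, hS'] at hdd
        refine hdd.unique hab (isDividedDifference_prod_X_pow ?_ ?_ ?_)
        · simp [a]; omega
        · intro i hi
          rw [Ne, Fin.ext_iff] at hi
          simp only [a] at hi
          split_ifs <;> omega
        · simp [a, b]; omega
    rw [aux m le_rfl w fun i => by rw [hw]; split_ifs <;> omega]
    refine Finset.prod_congr rfl fun i _ => ?_
    congr 1
    split_ifs <;> omega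

lemma apply_one (hS : IsSchubertFamily N S) : S 1 = 1 := by
  rw [hS.eq_prod_X_pow_of_reverse (Nat.zero_le N) 1 (by simp)]
  simp

lemma ne_zero (hS : IsSchubertFamily N S) (w : Perm' N) : S w ≠ 0 := by
  induction w using perm_induction_ascent with
  | one => rw [hS.apply_one]; exact one_ne_zero
  | step w i h hw ih =>
    have hi : i < N := by omega
    have := hS.isDividedDifference (w * Equiv.swap ⟨i, hi⟩ ⟨i + 1, h⟩) i h
      (by simpa using hw)
    rw [mul_assoc, Equiv.swap_mul_self, mul_one] at this
    intro h0
    rw [h0, IsDividedDifference, map_zero, sub_zero] at this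
    exact (mul_ne_zero (X_sub_X_ne_zero (by simp)) ih) this.symm

lemma constantCoeff_eq (hS : IsSchubertFamily N S) (w : Perm' N) :
    constantCoeff (S w) = if w = 1 then 1 else 0 := by
  induction w using perm_induction_ascent with
  | one => simp [hS.apply_one]
  | step w i h hw ih =>
    have hne : w * Equiv.swap ⟨i, by omega⟩ ⟨i + 1, h⟩ ≠ 1 := by
      intro h1
      rw [mul_eq_one_iff_eq_inv, Equiv.swap_inv] at h1
      simp [h1] at hw
    rw [if_neg hne]
    have hi : i < N := by omega
    have hdd := hS.isDividedDifference (w * Equiv.swap ⟨i, hi⟩ ⟨i + 1, h⟩) i h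
      (by simpa using hw)
    rw [mul_assoc, Equiv.swap_mul_self, mul_one] at hdd
    obtain ⟨k, hk⟩ := hS.exists_isHomogeneous (w * Equiv.swap ⟨i, by omega⟩ ⟨i + 1, h⟩)
    by_contra hc
    have hk0 := hk hc
    rw [map_zero] at hk0
    subst hk0
    have hC := hk.totalDegree_le
    rw [Nat.le_zero, totalDegree_eq_zero_iff_eq_C] at hC
    rw [IsDividedDifference, hC, rename_C, sub_self] at hdd
    exact mul_ne_zero (X_sub_X_ne_zero (by simp)) (hS.ne_zero w) hdd.symm

/-- Schubert polynomials are dual to their complements under the pairing given by `altCoeff`. -/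
lemma altCoeff_mul_w0_mul (hS : IsSchubertFamily N S) (v w : Perm' N) :
    altCoeff N (S v * S (w0 N * w)) = if v = w then 1 else 0 := by
  induction w using perm_induction_ascent generalizing v with
  | one => rw [mul_one, hS.1, altCoeff_mul_xDelta, hS.constantCoeff_eq]
  | step w i h hw ih =>
    have hdd := hS.isDividedDifference_w0_mul w i h hw
    set a : Fin N := ⟨i, by omega⟩
    set b : Fin N := ⟨i + 1, h⟩
    have hab : a ≠ b := by simp [a, b]
    rcases lt_or_gt_of_ne (v.injective.ne hab) with hv | hv
    · rw [← altCoeff_mul_comm_dividedDifference hab (hS.isDividedDifference_zero v i h hv) hdd,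
        zero_mul, map_zero, if_neg]
      rintro rfl
      simp only [Equiv.Perm.mul_apply, Equiv.swap_apply_left, Equiv.swap_apply_right] at hv
      exact lt_asymm hv hw
    · rw [← altCoeff_mul_comm_dividedDifference hab (hS.isDividedDifference v i h hv) hdd, ih]
      have hiff : v * Equiv.swap a b = w ↔ v = w * Equiv.swap a b := by
        rw [← eq_mul_inv_iff_mul_eq, Equiv.swap_inv]
      exact if_congr hiff rfl rfl

/-- The pairing with a Schubert polynomial annihilates the ideal of elementary
symmetric polynomials. -/
lemma altCoeff_mul_eq_zero_of_mem_symIdeal (hS : IsSchubertFamily N S)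
    {f : MvPolynomial (Fin N) ℤ} (hf : f ∈ symIdeal N) (v : Perm' N) :
    altCoeff N (f * S v) = 0 := by
  suffices ∀ w g, altCoeff N (f * g * S (w0 N * w)) = 0 by
    have := this (w0 N * v) 1
    rwa [← mul_assoc (w0 N), show w0 N * w0 N = 1 by ext; simp [w0], one_mul, mul_one] at this
  intro w
  have key (k : ℕ) (hk : k ∈ Set.Icc 1 N) (g : MvPolynomial (Fin N) ℤ) :
      altCoeff N (esymm (Fin N) ℤ k * g * S (w0 N * w)) = 0 := by
    induction w using perm_induction_ascent generalizing g with
    | one =>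
      rw [mul_one, hS.1, altCoeff_mul_xDelta, map_mul]
      have : constantCoeff (esymm (Fin N) ℤ k) = 0 := by
        rw [esymm, map_sum]
        refine Finset.sum_eq_zero fun t ht => ?_
        have hne : t.Nonempty := by
          rw [← Finset.card_pos, (Finset.mem_powersetCard.1 ht).2]
          exact hk.1
        rw [map_prod]
        simp [hne.card_pos.ne']
      rw [this, zero_mul]
    | step w i h hw ih =>
      have hab : (⟨i, by omega⟩ : Fin N) ≠ ⟨i + 1, h⟩ := by simp
      obtain ⟨g', hg⟩ := exists_isDividedDifference (⟨i, by omega⟩ : Fin N) ⟨i + 1, h⟩ g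
      rw [← altCoeff_mul_comm_dividedDifference hab
        (hg.symmetric_mul (esymm_isSymmetric (Fin N) ℤ k _))
        (hS.isDividedDifference_w0_mul w i h hw)]
      exact ih g'
  induction hf using Submodule.span_induction with
  | mem f hf =>
    obtain ⟨k, hk, rfl⟩ := hf
    exact key k hk
  | zero => simp
  | add f f' _ _ hf hf' =>
    intro g
    rw [add_mul, add_mul, map_add, hf, hf', add_zero]
  | smul r f _ hf =>
    intro g
    rw [smul_eq_mul, mul_comm r, mul_assoc f, hf]

end IsSchubertFamily

end Dominant

section Truncation

variable {n N : ℕ}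

/-- Setting the variables `x_i`, `i ≥ n`, to zero. -/
def truncVars (n N : ℕ) : MvPolynomial (Fin N) ℤ →ₐ[ℤ] MvPolynomial (Fin n) ℤ :=
  aeval fun i => if hi : (i : ℕ) < n then X ⟨i, hi⟩ else 0

lemma truncVars_X (i : Fin N) :
    truncVars n N (X i) = if hi : (i : ℕ) < n then X ⟨i, hi⟩ else 0 := by
  rw [truncVars, aeval_X]

lemma truncVars_X_castLE (h : n ≤ N) (i : Fin n) : truncVars n N (X (Fin.castLE h i)) = X i := by
  simp [truncVars_X]

lemma constantCoeff_truncVars (f : MvPolynomial (Fin N) ℤ) :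
    constantCoeff (truncVars n N f) = constantCoeff f := by
  have : (constantCoeff.comp (truncVars n N).toRingHom : MvPolynomial (Fin N) ℤ →+* ℤ) =
      constantCoeff := by
    apply MvPolynomial.ringHom_ext
    · intro r; simp
    · intro i
      simp only [RingHom.comp_apply, AlgHom.toRingHom_eq_coe, RingHom.coe_coe, truncVars_X]
      split_ifs <;> simp
  exact congrArg (fun φ => φ f) this

lemma truncVars_rename_swap (h : n ≤ N) (a b : Fin n) (f : MvPolynomial (Fin N) ℤ) :
    truncVars n N (rename (Equiv.swap (Fin.castLE h a) (Fin.castLE h b)) f) =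
      rename (Equiv.swap a b) (truncVars n N f) := by
  induction f using MvPolynomial.induction_on with
  | C r => simp
  | add p q hp hq => simp only [map_add, hp, hq]
  | mul_X p i hp =>
    rw [map_mul, map_mul, map_mul, map_mul, hp, rename_X]
    congr 1
    by_cases hi : (i : ℕ) < n
    · obtain ⟨j, rfl⟩ : ∃ j : Fin n, Fin.castLE h j = i := ⟨⟨i, hi⟩, rfl⟩
      rw [truncVars_X_castLE, rename_X, ← (Fin.castLE_injective h).map_swap, truncVars_X_castLE]
    · rw [Equiv.swap_apply_of_ne_of_ne, truncVars_X, dif_neg hi, map_zero] <;>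
      · rintro rfl
        simp at hi

lemma IsDividedDifference.truncVars (h : n ≤ N) {a b : Fin n} {f f' : MvPolynomial (Fin N) ℤ}
    (hf : IsDividedDifference (Fin.castLE h a) (Fin.castLE h b) f f') :
    IsDividedDifference a b (truncVars n N f) (truncVars n N f') := by
  have := congrArg (_root_.truncVars n N) hf
  rwa [map_sub, map_mul, map_sub, truncVars_rename_swap, truncVars_X_castLE,
    truncVars_X_castLE] at this

lemma permIncl_castLE (h : n ≤ N) (u : Perm' n) (i : Fin n) :
    permIncl h u (Fin.castLE h i) = Fin.castLE h (u i) :=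
  Equiv.Perm.extendDomain_apply_image u (finSubEquiv h) i

lemma permIncl_of_le (h : n ≤ N) (u : Perm' n) {i : Fin N} (hi : n ≤ i) : permIncl h u i = i :=
  Equiv.Perm.extendDomain_apply_not_subtype u (finSubEquiv h) (by simpa using hi)

lemma permIncl_one (h : n ≤ N) : permIncl h 1 = 1 :=
  Equiv.Perm.extendDomain_one _

lemma permIncl_mul_swap (h : n ≤ N) (u : Perm' n) (a b : Fin n) :
    permIncl h (u * Equiv.swap a b) =
      permIncl h u * Equiv.swap (Fin.castLE h a) (Fin.castLE h b) := by
  refine Equiv.ext fun i => ?_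
  by_cases hi : (i : ℕ) < n
  · obtain ⟨j, rfl⟩ : ∃ j : Fin n, Fin.castLE h j = i := ⟨⟨i, hi⟩, rfl⟩
    rw [Equiv.Perm.mul_apply, ← (Fin.castLE_injective h).map_swap, permIncl_castLE,
      permIncl_castLE, Equiv.Perm.mul_apply]
  · rw [Equiv.Perm.mul_apply, Equiv.swap_apply_of_ne_of_ne, permIncl_of_le h _ (by omega),
      permIncl_of_le h _ (by omega)] <;>
    · rintro rfl
      simp at hi

namespace IsSchubertFamily

variable {Sn : Perm' n → MvPolynomial (Fin n) ℤ} {SN : Perm' N → MvPolynomial (Fin N) ℤ}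

/-- Stability of Schubert polynomials. -/
lemma truncVars_apply_permIncl (h : n ≤ N) (hSn : IsSchubertFamily n Sn)
    (hSN : IsSchubertFamily N SN) (u : Perm' n) : truncVars n N (SN (permIncl h u)) = Sn u := by
  suffices ∀ u, truncVars n N (SN (permIncl h (w0 n * u))) = Sn (w0 n * u) by
    have := this (w0 n * u)
    rwa [← mul_assoc, show w0 n * w0 n = 1 by ext; simp [w0], one_mul] at this
  intro u
  induction u using perm_induction_ascent with
  | one =>
    rw [mul_one, hSn.1, hSN.eq_prod_X_pow_of_reverse h, xDelta, map_prod]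
    · rw [← Finset.prod_subset (Finset.subset_univ (Finset.univ.map (Fin.castLEEmb h)))]
      · rw [Finset.prod_map]
        simp [truncVars_X_castLE]
      · intro i _ hi
        have : n ≤ i := by
          by_contra hlt
          exact hi (Finset.mem_map.2 ⟨⟨i, by omega⟩, Finset.mem_univ _, rfl⟩)
        rw [show n - 1 - (i : ℕ) = 0 by omega, pow_zero, map_one]
    · intro i
      split_ifs with hi
      · obtain ⟨j, rfl⟩ : ∃ j : Fin n, Fin.castLE h j = i := ⟨⟨i, hi⟩, rfl⟩
        rw [permIncl_castLE]
        simp only [w0, Fin.revPerm_apply, Fin.val_castLE, Fin.val_rev]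
        omega
      · rw [permIncl_of_le h _ (by omega)]
  | step u i hi hu ih =>
    have hn := hSn.isDividedDifference_w0_mul u i hi hu
    have hN := hSN.isDividedDifference (permIncl h (w0 n * u)) i (by omega) (by
      have h1 := permIncl_castLE h (w0 n * u) ⟨i, by omega⟩
      have h2 := permIncl_castLE h (w0 n * u) ⟨i + 1, hi⟩
      rw [Fin.castLE_mk] at h1 h2
      rw [h1, h2]
      simpa [w0] using hu)
    have hN' := IsDividedDifference.truncVars h (a := ⟨i, by omega⟩) (b := ⟨i + 1, hi⟩) hN
    rw [ih] at hN'
    rw [← mul_assoc, permIncl_mul_swap]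
    rw [← mul_assoc] at hn
    exact hN'.unique (by simp) hn

lemma altCoeff_truncVars_mul (h : n ≤ N) (hSn : IsSchubertFamily n Sn)
    (hSN : IsSchubertFamily N SN) (w : Perm' n) (f : MvPolynomial (Fin N) ℤ) :
    altCoeff n (truncVars n N f * Sn (w0 n * w)) =
      altCoeff N (f * SN (w0 N * permIncl h w)) := by
  induction w using perm_induction_ascent generalizing f with
  | one =>
    rw [permIncl_one, mul_one, mul_one, hSn.1, hSN.1, altCoeff_mul_xDelta, altCoeff_mul_xDelta,
      constantCoeff_truncVars]
  | step w i hi hw ih =>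
    set a : Fin n := ⟨i, by omega⟩
    set b : Fin n := ⟨i + 1, hi⟩
    have hab : a ≠ b := by simp [a, b]
    obtain ⟨f', hf⟩ := exists_isDividedDifference (Fin.castLE h a) (Fin.castLE h b) f
    have hN := hSN.isDividedDifference_w0_mul (permIncl h w) i (by omega) (by
      have h1 := permIncl_castLE h w a
      have h2 := permIncl_castLE h w b
      simp only [a, b, Fin.castLE_mk] at h1 h2
      rw [h1, h2]
      exact hw)
    rw [permIncl_mul_swap,
      ← altCoeff_mul_comm_dividedDifference hab (hf.truncVars h)
        (hSn.isDividedDifference_w0_mul w i hi hw), ih f']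
    exact altCoeff_mul_comm_dividedDifference ((Fin.castLE_injective h).ne hab) hf hN

end IsSchubertFamily

end Truncation

/-- For `u ≤ w` in Bruhat order, the skew Schubert polynomial
`S_{w/u}` (the normal form of `S_u · S_{w₀w}`) expands as
`S_{w/u} = ∑_v c^w_{u,v} S_{w₀v}`, where the Littlewood–Richardson coefficients
`c^w_{u,v}` are defined by the expansion `S_u · S_v = ∑ c^w_{u,v} S_w` of stable
Schubert polynomials (computed in a symmetric group `Σ_N ⊇ Σ_n`). -/
theorem skew_schubert_eq_sum_LR (n N : ℕ) (hnN : n ≤ N)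
    (Sn : Perm' n → MvPolynomial (Fin n) ℤ) (hSn : IsSchubertFamily n Sn)
    (SN : Perm' N → MvPolynomial (Fin N) ℤ) (hSN : IsSchubertFamily N SN)
    (u w : Perm' n) (huw : BruhatLE u w)
    (c : Perm' n → Perm' N → ℤ)
    (hc : ∀ v : Perm' n,
      SN (permIncl hnN u) * SN (permIncl hnN v) = ∑ w' : Perm' N, c v w' • SN w')
    (skw : MvPolynomial (Fin n) ℤ)
    (hskw : IsNormalForm n (Sn u * Sn (w0 n * w)) skw) :
    skw = ∑ v : Perm' n, c v (permIncl hnN w) • Sn (w0 n * v) := by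
  let E : MvPolynomial (Fin n) ℤ →ₗ[ℤ] (Perm' n → ℤ) :=
    LinearMap.pi fun x => altCoeff n ∘ₗ LinearMap.mulRight ℤ (Sn x)
  have hE (f : MvPolynomial (Fin n) ℤ) (x : Perm' n) : E f x = altCoeff n (f * Sn x) := rfl
  have hcoeff (x : Perm' n) :
      c x (permIncl hnN w) = altCoeff n (Sn u * Sn (w0 n * w) * Sn x) := by
    have := hSn.altCoeff_truncVars_mul hnN hSN w (SN (permIncl hnN u) * SN (permIncl hnN x))
    rw [map_mul (truncVars n N), hSn.truncVars_apply_permIncl hnN hSN,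
      hSn.truncVars_apply_permIncl hnN hSN, hc, Finset.sum_mul, map_sum] at this
    simp only [smul_mul_assoc, map_smul, hSN.altCoeff_mul_w0_mul] at this
    rw [mul_right_comm, this]
    simp
  have hdual (v : Perm' n) : E (Sn (w0 n * v)) = Pi.single v 1 := by
    ext x
    rw [hE, mul_comm, hSn.altCoeff_mul_w0_mul, Pi.single_apply]
  rw [← sub_eq_zero]
  refine staircase_injective E (fun v => Sn (w0 n * v)) (fun v => hSn.mem_staircase _) hdual
    (sub_mem (fun d hd => hskw.2 d hd) (sum_mem fun v _ => Submodule.smul_mem _ _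
      (hSn.mem_staircase _))) ?_
  have hskw' (x : Perm' n) : altCoeff n (skw * Sn x) =
      altCoeff n (Sn u * Sn (w0 n * w) * Sn x) := by
    have := hSn.altCoeff_mul_eq_zero_of_mem_symIdeal hskw.1 x
    rw [sub_mul, map_sub] at this
    omega
  rw [map_sub, map_sum, sub_eq_zero]
  ext x
  rw [hE, hskw', ← hcoeff, Finset.sum_apply]
  simp only [map_smul, hdual, Pi.smul_apply, Pi.single_apply, smul_eq_mul, mul_ite, mul_one,
    mul_zero, Finset.sum_ite_eq, Finset.mem_univ, if_true]
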